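/- arXiv:2307.09722 — 2 statements merged into one kernel-verified Lean document; each statement's English description precedes it below -/
import Mathlib

section
/- Assume Dynamics Smoothness holds and that the submatrix Φ_{EJ}(T) of the fundamental matrix at the terminal time is invertible, with γ = ‖Φ_{EJ}(T)⁻¹‖. Then there is a neighborhood N of the origin in ℝ^{|E|} and a constant c such that for every π ∈ N the perturbed boundary-value problem ẋ(t) = F(x(t),t), x_I(0) = b_I, x_E(T) = b_E + π has a solution x^π, and ‖x^π_J(0) − x_J(0)‖ ≤ c‖π‖ for all π ∈ N; moreover, for every c' > γ the neighborhood N can be chosen so that the bound holds with constant c'. -/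
open Set Metric

/-- **Dynamics Smoothness** for a dynamics `Fd` with spatial Jacobian `DFd`, on the tube
`{(χ,t) : t ∈ [a,b], ‖χ - x t‖ ≤ ρ}` around the trajectory `x` :
`Fd` is continuously differentiable on the tube, and `χ ↦ DFd χ t` is Lipschitz
with constant `L`, uniformly in `t`. -/
structure DynSmooth (n : ℕ) (Fd : (Fin n → ℝ) → ℝ → Fin n → ℝ)
    (DFd : (Fin n → ℝ) → ℝ → (Fin n → ℝ) →L[ℝ] (Fin n → ℝ))
    (x : ℝ → Fin n → ℝ) (a b ρ L : ℝ) : Prop where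
  contDiffOn : ContDiffOn ℝ 1 (fun p : (Fin n → ℝ) × ℝ => Fd p.1 p.2)
    {p : (Fin n → ℝ) × ℝ | p.2 ∈ Icc a b ∧ ‖p.1 - x p.2‖ ≤ ρ}
  hasFDeriv : ∀ χ t, t ∈ Icc a b → ‖χ - x t‖ ≤ ρ →
    HasFDerivAt (fun y => Fd y t) (DFd χ t) χ
  contDeriv : ContinuousOn (fun p : (Fin n → ℝ) × ℝ => DFd p.1 p.2)
    {p : (Fin n → ℝ) × ℝ | p.2 ∈ Icc a b ∧ ‖p.1 - x p.2‖ ≤ ρ}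
  lip : ∀ t χ₁ χ₂, t ∈ Icc a b → ‖χ₁ - x t‖ ≤ ρ → ‖χ₂ - x t‖ ≤ ρ →
    ‖DFd χ₁ t - DFd χ₂ t‖ ≤ L * ‖χ₁ - χ₂‖

/-- `xπ` is a solution of the boundary-value problem with switched dynamics
(`F₀` before the switch point `s`, `F₁` after), initial condition `xπ_I(0) = b_I`
and perturbed terminal condition `xπ_E(T) = b_E + π`. -/
def IsPertSol {n : ℕ} (T s : ℝ) (I E : Finset (Fin n)) (bI bE : Fin n → ℝ)
    (F₀ F₁ : (Fin n → ℝ) → ℝ → Fin n → ℝ) (π : {e // e ∈ E} → ℝ)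
    (xπ : ℝ → Fin n → ℝ) : Prop :=
  ContinuousOn xπ (Icc 0 T) ∧
  (∀ t ∈ Ico 0 s, HasDerivWithinAt xπ (F₀ (xπ t) t) (Icc 0 T) t) ∧
  (∀ t ∈ Ioc s T, HasDerivWithinAt xπ (F₁ (xπ t) t) (Icc 0 T) t) ∧
  (∀ i ∈ I, xπ 0 i = bI i) ∧
  (∀ e : {e // e ∈ E}, xπ T e.1 = bE e.1 + π e)


lemma bvp_core {V : Type*} [NormedAddCommGroup V] [NormedSpace ℝ V] [CompleteSpace V]
    (T s : ℝ) (hs : s ∈ Ioo 0 T) (h₀ h₁ : V → ℝ → V)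
    (hc₀ : Continuous (fun p : V × ℝ => h₀ p.1 p.2))
    (hc₁ : Continuous (fun p : V × ℝ => h₁ p.1 p.2))
    (κ : ℝ) (hκ : 0 ≤ κ)
    (hl₀ : ∀ t u v, ‖h₀ u t - h₀ v t‖ ≤ κ * ‖u - v‖)
    (hl₁ : ∀ t u v, ‖h₁ u t - h₁ v t‖ ≤ κ * ‖u - v‖)
    (hz₀ : ∀ t, h₀ 0 t = 0) (hz₁ : ∀ t, h₁ 0 t = 0)
    (B : V →L[ℝ] V) (a₀ : V) (q : ℝ) (hq : q < 1) (hκq : κ * T * (1 + ‖B‖) ≤ q) :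
    ∃ z : ℝ → V, Continuous z ∧ (∀ t, ‖z t‖ ≤ ‖a₀‖ / (1 - q)) ∧
      (∀ t ∈ Ico 0 s, HasDerivWithinAt z (h₀ (z t) t) (Icc 0 T) t) ∧
      (∀ t ∈ Ioc s T, HasDerivWithinAt z (h₁ (z t) t) (Icc 0 T) t) ∧
      z 0 = a₀ - B (z T - z 0) := by
  obtain ⟨hs0, hsT⟩ := hs
  have hT : 0 < T := hs0.trans hsT
  have hq0 : 0 ≤ q := le_trans (by positivity) hκq
  let e : C(Icc (0:ℝ) T, V) → ℝ → V := fun z => IccExtend hT.le z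
  have he : ∀ z : C(Icc (0:ℝ) T, V), Continuous (e z) := fun z => z.continuous.Icc_extend'
  have hi₀ : ∀ z : C(Icc (0:ℝ) T, V), Continuous (fun τ => h₀ (e z τ) τ) := fun z =>
    hc₀.comp ((he z).prodMk continuous_id)
  have hi₁ : ∀ z : C(Icc (0:ℝ) T, V), Continuous (fun τ => h₁ (e z τ) τ) := fun z =>
    hc₁.comp ((he z).prodMk continuous_id)
  let P : C(Icc (0:ℝ) T, V) → ℝ → V := fun z t =>
    (∫ τ in (0:ℝ)..(min t s), h₀ (e z τ) τ) + ∫ τ in s..(max t s), h₁ (e z τ) τ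
  have hP : ∀ z, Continuous (P z) := fun z => by
    have c0 := intervalIntegral.continuous_primitive (μ := MeasureTheory.volume)
      (fun a b => (hi₀ z).intervalIntegrable a b) 0
    have c1 := intervalIntegral.continuous_primitive (μ := MeasureTheory.volume)
      (fun a b => (hi₁ z).intervalIntegrable a b) s
    exact (c0.comp (continuous_id.min continuous_const)).add
      (c1.comp (continuous_id.max continuous_const))
  have hed : ∀ (z w : C(Icc (0:ℝ) T, V)) τ, ‖e z τ - e w τ‖ ≤ ‖z - w‖ := fun z w τ => by
    have := (z - w).norm_coe_le_norm (projIcc 0 T hT.le τ)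
    simpa [e, IccExtend] using this
  have hPd : ∀ (z w : C(Icc (0:ℝ) T, V)) t, t ∈ Icc 0 T → ‖P z t - P w t‖ ≤ κ * T * ‖z - w‖ := by
    intro z w t ht
    have e1 : P z t - P w t = (∫ τ in (0:ℝ)..(min t s), (h₀ (e z τ) τ - h₀ (e w τ) τ)) +
        ∫ τ in s..(max t s), (h₁ (e z τ) τ - h₁ (e w τ) τ) := by
      rw [intervalIntegral.integral_sub ((hi₀ z).intervalIntegrable _ _)
        ((hi₀ w).intervalIntegrable _ _), intervalIntegral.integral_sub
        ((hi₁ z).intervalIntegrable _ _) ((hi₁ w).intervalIntegrable _ _)]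
      simp only [P]; abel
    have b0 := intervalIntegral.norm_integral_le_of_norm_le_const (a := 0) (b := min t s)
      (f := fun τ => h₀ (e z τ) τ - h₀ (e w τ) τ) (C := κ * ‖z - w‖)
      (fun τ _ => (hl₀ _ _ _).trans (mul_le_mul_of_nonneg_left (hed z w τ) hκ))
    have b1 := intervalIntegral.norm_integral_le_of_norm_le_const (a := s) (b := max t s)
      (f := fun τ => h₁ (e z τ) τ - h₁ (e w τ) τ) (C := κ * ‖z - w‖)
      (fun τ _ => (hl₁ _ _ _).trans (mul_le_mul_of_nonneg_left (hed z w τ) hκ))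
    have m0 : |min t s - 0| = min t s := by
      rw [sub_zero, abs_of_nonneg (le_min ht.1 hs0.le)]
    have m1 : |max t s - s| = max t s - s := abs_of_nonneg (by simp)
    have m2 : min t s + (max t s - s) = t := by
      have := min_add_max t s; linarith
    rw [m0] at b0; rw [m1] at b1
    rw [e1]
    calc _ ≤ _ := norm_add_le _ _
      _ ≤ κ * ‖z - w‖ * (min t s) + κ * ‖z - w‖ * (max t s - s) := add_le_add b0 b1
      _ = κ * ‖z - w‖ * t := by rw [← mul_add, m2]
      _ ≤ κ * ‖z - w‖ * T := by gcongr; exact ht.2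
      _ = _ := by ring
  let K : C(Icc (0:ℝ) T, V) → C(Icc (0:ℝ) T, V) := fun z => ⟨fun t => (a₀ - B (P z T)) + P z t,
    continuous_const.add ((hP z).comp continuous_subtype_val)⟩
  have hKd : ∀ z w, ‖K z - K w‖ ≤ q * ‖z - w‖ := by
    intro z w
    rw [ContinuousMap.norm_le _ (by positivity)]
    intro t
    have e1 : (K z - K w) t = (P z t - P w t) - B (P z T - P w T) := by
      simp only [K, ContinuousMap.sub_apply, ContinuousMap.coe_mk, map_sub]; abel
    rw [e1]
    calc _ ≤ _ := norm_sub_le _ _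
      _ ≤ κ * T * ‖z - w‖ + ‖B‖ * (κ * T * ‖z - w‖) :=
        add_le_add (hPd z w t t.2) ((B.le_opNorm _).trans
          (mul_le_mul_of_nonneg_left (hPd z w T ⟨hT.le, le_rfl⟩) (norm_nonneg _)))
      _ = κ * T * (1 + ‖B‖) * ‖z - w‖ := by ring
      _ ≤ _ := by gcongr
  have hcon : ContractingWith ⟨q, hq0⟩ K := by
    refine ⟨by exact_mod_cast hq, LipschitzWith.of_dist_le_mul fun z w => ?_⟩
    rw [dist_eq_norm, dist_eq_norm]; exact hKd z w
  obtain ⟨z, hz⟩ : ∃ z, K z = z := ⟨_, hcon.fixedPoint_isFixedPt⟩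
  have hP0 : ∀ t ∈ Icc 0 T, P 0 t = 0 := by
    intro t _
    simp [P, e, IccExtend, hz₀, hz₁]
  have hK0 : ‖K 0‖ ≤ ‖a₀‖ := by
    rw [ContinuousMap.norm_le _ (norm_nonneg _)]
    intro t
    simp [K, hP0 t t.2, hP0 T ⟨hT.le, le_rfl⟩]
  have hzn : ‖z‖ ≤ ‖a₀‖ / (1 - q) := by
    rw [le_div_iff₀ (by linarith)]
    have h1 := hKd z 0
    rw [hz, sub_zero] at h1
    have h2 := norm_le_norm_sub_add z (K 0)
    linarith
  have hzt : ∀ t ∈ Icc 0 T, e z t = (a₀ - B (P z T)) + P z t := by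
    intro t ht
    have : e z t = z ⟨t, ht⟩ := IccExtend_of_mem _ _ ht
    rw [this]; nth_rw 1 [← hz]; rfl
  refine ⟨e z, he z, fun t => ?_, ?_, ?_, ?_⟩
  · exact (z.norm_coe_le_norm _).trans hzn
  · intro t ht
    have htT : t ∈ Icc 0 T := ⟨ht.1, (ht.2.trans hsT).le⟩
    have d : HasDerivAt (fun u => (a₀ - B (P z T)) + ∫ τ in (0:ℝ)..u, h₀ (e z τ) τ)
      (h₀ (e z t) t) t := ((hi₀ z).integral_hasStrictDerivAt 0 t).hasDerivAt.const_add _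
    refine d.hasDerivWithinAt.congr_of_eventuallyEq_of_mem ?_ htT
    filter_upwards [self_mem_nhdsWithin, mem_nhdsWithin_of_mem_nhds (Iio_mem_nhds ht.2)] with u hu hu2
    have hu3 : u ≤ s := le_of_lt (mem_Iio.1 hu2)
    rw [hzt u hu]
    simp [P, min_eq_left hu3, max_eq_right hu3]
  · intro t ht
    have htT : t ∈ Icc 0 T := ⟨(hs0.trans ht.1).le, ht.2⟩
    have d : HasDerivAt (fun u => (a₀ - B (P z T)) + ((∫ τ in (0:ℝ)..s, h₀ (e z τ) τ) +
        ∫ τ in s..u, h₁ (e z τ) τ))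
      (h₁ (e z t) t) t :=
        (((hi₁ z).integral_hasStrictDerivAt s t).hasDerivAt.const_add _).const_add _
    refine d.hasDerivWithinAt.congr_of_eventuallyEq_of_mem ?_ htT
    filter_upwards [self_mem_nhdsWithin, mem_nhdsWithin_of_mem_nhds (Ioi_mem_nhds ht.1)] with u hu hu2
    have hu3 : s ≤ u := le_of_lt (mem_Ioi.1 hu2)
    rw [hzt u hu]
    simp [P, min_eq_right hu3, max_eq_left hu3]
  · have p0 : P z 0 = 0 := by simp [P, hs0.le]
    rw [hzt 0 ⟨le_rfl, hT.le⟩, hzt T ⟨hT.le, le_rfl⟩, p0]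
    simp

lemma backward_zero {V : Type*} [NormedAddCommGroup V] [NormedSpace ℝ V]
    (a b : ℝ) (hab : a ≤ b) (f : ℝ → V) (A : ℝ → V →L[ℝ] V)
    (hf : ContinuousOn f (Icc a b)) (hA : ContinuousOn A (Icc a b))
    (hd : ∀ t ∈ Ioo a b, HasDerivAt f (A t (f t)) t) (hb : f b = 0) : f a = 0 := by
  rcases hab.eq_or_lt with rfl | hab
  · exact hb
  obtain ⟨C, hC⟩ := isCompact_Icc.exists_bound_of_continuousOn hA
  have hC0 : 0 ≤ C := (norm_nonneg _).trans (hC a ⟨le_rfl, hab.le⟩)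
  have hIoo : Ioo a b ∈ nhdsWithin b (Iio b) := Ioo_mem_nhdsLT hab
  have hle : nhdsWithin b (Iio b) ≤ nhdsWithin b (Icc a b) :=
    nhdsWithin_le_of_mem (Filter.mem_of_superset hIoo Ioo_subset_Icc_self)
  have hbb : HasDerivWithinAt f (A b (f b)) (Iic b) b := by
    refine hasDerivWithinAt_Iic_of_tendsto_deriv (s := Ioo a b)
      (fun t ht => (hd t ht).differentiableAt.differentiableWithinAt)
      ((hf b ⟨hab.le, le_rfl⟩).mono Ioo_subset_Icc_self) hIoo ?_
    have hc : ContinuousWithinAt (fun t => A t (f t)) (Icc a b) b :=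
      (hA b ⟨hab.le, le_rfl⟩).clm_apply (hf b ⟨hab.le, le_rfl⟩)
    refine (Filter.Tendsto.mono_left hc hle).congr' ?_
    filter_upwards [hIoo] with t ht using (hd t ht).deriv.symm
  have := ODE_solution_unique_of_mem_Icc_left (v := fun t y => A t y) (s := fun _ => univ)
    (K := ⟨C, hC0⟩) (f := f) (g := fun _ => 0) (a := a) (b := b)
    (fun t ht => by
      refine (LipschitzWith.of_dist_le_mul fun u v => ?_).lipschitzOnWith
      rw [dist_eq_norm, dist_eq_norm, ← map_sub]
      exact ((A t).le_opNorm _).trans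
        (mul_le_mul_of_nonneg_right (hC t ⟨ht.1.le, ht.2⟩) (norm_nonneg _)))
    hf
    (fun t ht => by
      rcases ht.2.eq_or_lt with rfl | h
      · exact hbb
      · exact (hd t ⟨ht.1, h⟩).hasDerivWithinAt)
    (fun _ _ => mem_univ _) continuousOn_const
    (fun t _ => by simpa using hasDerivWithinAt_const t (Iic t) (0:V))
    (fun _ _ => mem_univ _) hb
  exact this ⟨le_rfl, hab.le⟩

/-- componentwise truncation -/
def clampV {n : ℕ} (δ : ℝ) (w : Fin n → ℝ) : Fin n → ℝ := fun i => max (-δ) (min δ (w i))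

lemma clampV_cont {n : ℕ} (δ : ℝ) : Continuous (clampV (n := n) δ) := by
  unfold clampV; fun_prop

lemma clampV_norm {n : ℕ} (δ : ℝ) (hδ : 0 ≤ δ) (w : Fin n → ℝ) : ‖clampV δ w‖ ≤ δ := by
  rw [pi_norm_le_iff_of_nonneg hδ]
  intro i
  rw [Real.norm_eq_abs, abs_le]
  exact ⟨le_max_left _ _, max_le (by linarith) (min_le_left _ _)⟩

lemma clampV_eq {n : ℕ} (δ : ℝ) (w : Fin n → ℝ) (hw : ‖w‖ ≤ δ) : clampV δ w = w := by
  funext i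
  have := (norm_le_pi_norm w i).trans hw
  rw [Real.norm_eq_abs, abs_le] at this
  simp [clampV, this.1, this.2]

lemma clampV_lip {n : ℕ} (δ : ℝ) (u v : Fin n → ℝ) : ‖clampV δ u - clampV δ v‖ ≤ ‖u - v‖ := by
  rw [pi_norm_le_iff_of_nonneg (norm_nonneg _)]
  intro i
  refine le_trans ?_ (norm_le_pi_norm (u - v) i)
  simp only [clampV, Pi.sub_apply, Real.norm_eq_abs]
  refine (abs_max_sub_max_le_max _ _ _ _).trans (max_le (by simp) ?_)
  exact (abs_min_sub_min_le_max _ _ _ _).trans (max_le (by simp) le_rfl)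

lemma DynSmooth.mono' {n : ℕ} {F DF x} {a b a' b' ρ L : ℝ} (h : DynSmooth n F DF x a b ρ L)
    (ha : a ≤ a') (hb : b' ≤ b) : DynSmooth n F DF x a' b' ρ L := by
  have hs : Icc a' b' ⊆ Icc a b := Icc_subset_Icc ha hb
  exact ⟨h.contDiffOn.mono fun p hp => ⟨hs hp.1, hp.2⟩,
    fun χ t ht => h.hasFDeriv χ t (hs ht),
    h.contDeriv.mono fun p hp => ⟨hs hp.1, hp.2⟩,
    fun t χ₁ χ₂ ht => h.lip t χ₁ χ₂ (hs ht)⟩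

lemma DynSmooth.contA {n : ℕ} {F DF x} {a b ρ L : ℝ} (h : DynSmooth n F DF x a b ρ L)
    (hρ : 0 ≤ ρ) (hx : ContinuousOn x (Icc a b)) :
    ContinuousOn (fun t => DF (x t) t) (Icc a b) :=
  h.contDeriv.comp (f := fun t => (x t, t)) (hx.prodMk continuousOn_id)
    fun t ht => ⟨ht, by simpa using hρ⟩

lemma DynSmooth.remainder {n : ℕ} {F DF x} {a b ρ L : ℝ} (h : DynSmooth n F DF x a b ρ L)
    {δ : ℝ} (hδ : 0 ≤ δ) (hδρ : δ ≤ ρ) {t : ℝ} (ht : t ∈ Icc a b) {u v : Fin n → ℝ}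
    (hu : ‖u‖ ≤ δ) (hv : ‖v‖ ≤ δ) :
    ‖(F (x t + u) t - F (x t) t - DF (x t) t u) - (F (x t + v) t - F (x t) t - DF (x t) t v)‖
      ≤ |L| * δ * ‖u - v‖ := by
  have key := (convex_closedBall (x t) δ).norm_image_sub_le_of_norm_hasFDerivWithin_le'
    (𝕜 := ℝ) (f := fun y => F y t) (f' := fun y => DF y t) (φ := DF (x t) t) (C := |L| * δ)
    (x := x t + v) (y := x t + u)
    (fun y hy => (h.hasFDeriv y t ht ((mem_closedBall_iff_norm.1 hy).trans hδρ)).hasFDerivWithinAt)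
    (fun y hy => by
      have hy' := mem_closedBall_iff_norm.1 hy
      refine (h.lip t y (x t) ht (hy'.trans hδρ) (by simpa using hδ.trans hδρ)).trans ?_
      exact (mul_le_mul_of_nonneg_right (le_abs_self L) (norm_nonneg _)).trans
        (mul_le_mul_of_nonneg_left hy' (abs_nonneg _)))
    (by simpa using hv) (by simpa using hu)
  have e1 : x t + u - (x t + v) = u - v := by abel
  rw [e1, map_sub] at key
  have e2 : (F (x t + u) t - F (x t) t - DF (x t) t u) -
      (F (x t + v) t - F (x t) t - DF (x t) t v) =
      F (x t + u) t - F (x t + v) t - (DF (x t) t u - DF (x t) t v) := by abel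
  rw [e2]
  exact key

lemma DynSmooth.piece {n : ℕ} {F DF x} {a b ρ L : ℝ} (h : DynSmooth n F DF x a b ρ L)
    (hab : a ≤ b) (hx : ContinuousOn x (Icc a b))
    (Φ Ψ : ℝ → (Fin n → ℝ) →L[ℝ] (Fin n → ℝ))
    (hΦ : ContinuousOn Φ (Icc a b)) (hΨ : ContinuousOn Ψ (Icc a b)) (M : ℝ)
    (hΦM : ∀ t ∈ Icc a b, ‖Φ t‖ ≤ M) (hΨM : ∀ t ∈ Icc a b, ‖Ψ t‖ ≤ M)
    {δ : ℝ} (hδ : 0 ≤ δ) (hδρ : δ ≤ ρ) :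
    ∃ g : (Fin n → ℝ) → ℝ → (Fin n → ℝ), Continuous (fun p : (Fin n → ℝ) × ℝ => g p.1 p.2) ∧
      (∀ t u v, ‖g u t - g v t‖ ≤ (M * (|L| * δ) * M) * ‖u - v‖) ∧ (∀ t, g 0 t = 0) ∧
      (∀ t ∈ Icc a b, ∀ v, ‖Φ t v‖ ≤ δ →
        g v t = Ψ t (F (x t + Φ t v) t - F (x t) t - DF (x t) t (Φ t v))) := by
  have hM : 0 ≤ M := (norm_nonneg _).trans (hΦM a ⟨le_rfl, hab⟩)
  let H : (Fin n → ℝ) × ℝ → Fin n → ℝ := fun p => Ψ p.2 (F (x p.2 + clampV δ (Φ p.2 p.1)) p.2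
    - F (x p.2) p.2 - DF (x p.2) p.2 (clampV δ (Φ p.2 p.1)))
  have hH : ContinuousOn H (univ ×ˢ Icc a b) := by
    have m2 : MapsTo (Prod.snd : (Fin n → ℝ) × ℝ → ℝ) (univ ×ˢ Icc a b) (Icc a b) :=
      fun p hp => hp.2
    have c2 : ContinuousOn (Prod.snd : (Fin n → ℝ) × ℝ → ℝ) (univ ×ˢ Icc a b) :=
      continuous_snd.continuousOn
    have cx : ContinuousOn (fun p : (Fin n → ℝ) × ℝ => x p.2) (univ ×ˢ Icc a b) := hx.comp c2 m2
    have cΦ : ContinuousOn (fun p : (Fin n → ℝ) × ℝ => Φ p.2) (univ ×ˢ Icc a b) := hΦ.comp c2 m2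
    have cΨ : ContinuousOn (fun p : (Fin n → ℝ) × ℝ => Ψ p.2) (univ ×ˢ Icc a b) := hΨ.comp c2 m2
    have cA : ContinuousOn (fun p : (Fin n → ℝ) × ℝ => DF (x p.2) p.2) (univ ×ˢ Icc a b) :=
      (h.contA (hδ.trans hδρ) hx).comp c2 m2
    have cw : ContinuousOn (fun p : (Fin n → ℝ) × ℝ => clampV δ (Φ p.2 p.1)) (univ ×ˢ Icc a b) :=
      (clampV_cont δ).comp_continuousOn (cΦ.clm_apply continuous_fst.continuousOn)
    have cF1 : ContinuousOn (fun p : (Fin n → ℝ) × ℝ => F (x p.2 + clampV δ (Φ p.2 p.1)) p.2)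
        (univ ×ˢ Icc a b) :=
      h.contDiffOn.continuousOn.comp
        (f := fun p : (Fin n → ℝ) × ℝ => (x p.2 + clampV δ (Φ p.2 p.1), p.2))
        ((cx.add cw).prodMk c2)
        (fun p hp => ⟨hp.2, by simpa using (clampV_norm δ hδ _).trans hδρ⟩)
    have cF0 : ContinuousOn (fun p : (Fin n → ℝ) × ℝ => F (x p.2) p.2)
        (univ ×ˢ Icc a b) :=
      h.contDiffOn.continuousOn.comp (f := fun p : (Fin n → ℝ) × ℝ => (x p.2, p.2))
        (cx.prodMk c2) (fun p hp => ⟨hp.2, by simpa using hδ.trans hδρ⟩)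
    exact cΨ.clm_apply ((cF1.sub cF0).sub (cA.clm_apply cw))
  refine ⟨fun v t => H (v, projIcc a b hab t), ?_, ?_, ?_, ?_⟩
  · refine hH.comp_continuous (f := fun p : (Fin n → ℝ) × ℝ =>
      (p.1, ((projIcc a b hab p.2 : Icc a b) : ℝ))) ?_ (fun p => ⟨mem_univ _, Subtype.coe_prop _⟩)
    exact continuous_fst.prodMk (continuous_subtype_val.comp (continuous_projIcc.comp continuous_snd))
  · intro t u v
    have ht : ((projIcc a b hab t : Icc a b) : ℝ) ∈ Icc a b := Subtype.coe_prop _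
    beta_reduce
    generalize ((projIcc a b hab t : Icc a b) : ℝ) = τ at ht ⊢
    simp only [H]
    rw [← map_sub]
    have r := h.remainder hδ hδρ ht (clampV_norm δ hδ (Φ τ u)) (clampV_norm δ hδ (Φ τ v))
    have r2 : ‖clampV δ (Φ τ u) - clampV δ (Φ τ v)‖ ≤ M * ‖u - v‖ := by
      refine (clampV_lip _ _ _).trans ?_
      rw [← map_sub]
      exact ((Φ τ).le_opNorm _).trans (mul_le_mul_of_nonneg_right (hΦM τ ht) (norm_nonneg _))
    calc _ ≤ _ := (Ψ τ).le_opNorm _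
      _ ≤ M * (|L| * δ * (M * ‖u - v‖)) := by
        refine mul_le_mul (hΨM τ ht) (r.trans ?_) (norm_nonneg _) hM
        exact mul_le_mul_of_nonneg_left r2 (by positivity)
      _ = _ := by ring
  · intro t
    have : clampV δ (0 : Fin n → ℝ) = 0 := clampV_eq _ _ (by simpa using hδ)
    simp [H, this]
  · intro t ht v hv
    simp only [H, projIcc_of_mem hab ht, clampV_eq _ _ hv]

/-- extension by zero from `J` to all indices -/
def embJ {n : ℕ} (J : Finset (Fin n)) : ({j // j ∈ J} → ℝ) →ₗ[ℝ] (Fin n → ℝ) where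
  toFun u i := if h : i ∈ J then u ⟨i, h⟩ else 0
  map_add' u v := by funext i; by_cases h : i ∈ J <;> simp [h]
  map_smul' c u := by funext i; by_cases h : i ∈ J <;> simp [h]

lemma embJ_mem {n : ℕ} (J : Finset (Fin n)) (u : {j // j ∈ J} → ℝ) (j : {j // j ∈ J}) :
    embJ J u j.1 = u j := by
  simp [embJ]

lemma embJ_not_mem {n : ℕ} (J : Finset (Fin n)) (u : {j // j ∈ J} → ℝ) (i : Fin n)
    (hi : i ∉ J) : embJ J u i = 0 := by
  simp [embJ, hi]

lemma embJ_norm {n : ℕ} (J : Finset (Fin n)) (u : {j // j ∈ J} → ℝ) : ‖embJ J u‖ ≤ ‖u‖ := by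
  rw [pi_norm_le_iff_of_nonneg (norm_nonneg _)]
  intro i
  by_cases h : i ∈ J
  · rw [embJ_mem J u ⟨i, h⟩]; exact norm_le_pi_norm u _
  · rw [embJ_not_mem J u i h]; simp

lemma apply_embJ {n : ℕ} (J E : Finset (Fin n)) (A : (Fin n → ℝ) →L[ℝ] (Fin n → ℝ))
    (u : {j // j ∈ J} → ℝ) (e : {e // e ∈ E}) :
    A (embJ J u) e.1 = ((LinearMap.toMatrix' (A : (Fin n → ℝ) →ₗ[ℝ] Fin n → ℝ)).submatrix
        (Subtype.val : {e // e ∈ E} → Fin n) (Subtype.val : {j // j ∈ J} → Fin n)).mulVec u e := by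
  have h1 : A (embJ J u) =
      (LinearMap.toMatrix' (A : (Fin n → ℝ) →ₗ[ℝ] Fin n → ℝ)).mulVec (embJ J u) := by
    rw [LinearMap.toMatrix'_mulVec]; rfl
  rw [h1]
  simp only [Matrix.mulVec, dotProduct, Matrix.submatrix_apply]
  rw [← Finset.sum_subset (Finset.subset_univ J)
    (fun i _ hi => by rw [embJ_not_mem J u i hi, mul_zero]), ← Finset.sum_coe_sort J]
  exact Finset.sum_congr rfl fun j _ => by rw [embJ_mem]

/-- Lemma 3.1: stability with respect to the terminal constraint. -/
theorem stability_terminal_constraint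
    {n : ℕ} (hn : 0 < n) (T s ρ L : ℝ) (hT : 0 < T) (hs : s ∈ Ioo 0 T) (hρ : 0 < ρ)
    (I E : Finset (Fin n)) (hcard : I.card + E.card = n)
    (bI bE : Fin n → ℝ)
    (F₀ F₁ : (Fin n → ℝ) → ℝ → Fin n → ℝ)
    (DF₀ DF₁ : (Fin n → ℝ) → ℝ → (Fin n → ℝ) →L[ℝ] (Fin n → ℝ))
    (x : ℝ → Fin n → ℝ)
    -- `x` solves the unperturbed boundary-value problem
    (hx : IsPertSol T s I E bI bE F₀ F₁ (0 : {e // e ∈ E} → ℝ) x)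
    -- Dynamics Smoothness on the two tubes
    (hds₀ : DynSmooth n F₀ DF₀ x 0 (s + ρ) ρ L)
    (hds₁ : DynSmooth n F₁ DF₁ x (s - ρ) T ρ L)
    -- the fundamental matrix `Φ` of the linearized dynamics along `x`
    (Φ : ℝ → (Fin n → ℝ) →L[ℝ] (Fin n → ℝ))
    (hΦc : ContinuousOn Φ (Icc 0 T))
    (hΦ0 : Φ 0 = ContinuousLinearMap.id ℝ (Fin n → ℝ))
    (hΦode : ∀ t ∈ Icc 0 T, t ≠ s → HasDerivWithinAt Φ
      ((if t < s then DF₀ (x t) t else DF₁ (x t) t).comp (Φ t)) (Icc 0 T) t)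
    -- `N` is the inverse of the submatrix `Φ_{EJ}(T)`, where `J = Iᶜ`
    (N : Matrix {j // j ∈ Iᶜ} {e // e ∈ E} ℝ)
    (hN₁ : (LinearMap.toMatrix' (Φ T : (Fin n → ℝ) →ₗ[ℝ] Fin n → ℝ)).submatrix
        (Subtype.val : {e // e ∈ E} → Fin n) (Subtype.val : {j // j ∈ Iᶜ} → Fin n) * N = 1)
    (hN₂ : N * (LinearMap.toMatrix' (Φ T : (Fin n → ℝ) →ₗ[ℝ] Fin n → ℝ)).submatrix
        (Subtype.val : {e // e ∈ E} → Fin n) (Subtype.val : {j // j ∈ Iᶜ} → Fin n) = 1) :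
    -- there is a neighborhood of the origin and a constant `c` such that the perturbed
    -- problem has a solution whose unknown initial components move by at most `c‖π‖` …
    (∃ ε > (0 : ℝ), ∃ c : ℝ, ∀ π : {e // e ∈ E} → ℝ, ‖π‖ ≤ ε →
      ∃ xπ : ℝ → Fin n → ℝ, IsPertSol T s I E bI bE F₀ F₁ π xπ ∧
        ‖(fun j : {j // j ∈ Iᶜ} => xπ 0 j.1 - x 0 j.1)‖ ≤ c * ‖π‖) ∧
    -- … and moreover any constant `c' > γ = ‖Φ_{EJ}(T)⁻¹‖` works on a suitable neighborhood
    (∀ c' : ℝ, c' > ‖LinearMap.toContinuousLinearMap (Matrix.mulVecLin N)‖ →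
      ∃ ε > (0 : ℝ), ∀ π : {e // e ∈ E} → ℝ, ‖π‖ ≤ ε →
      ∃ xπ : ℝ → Fin n → ℝ, IsPertSol T s I E bI bE F₀ F₁ π xπ ∧
        ‖(fun j : {j // j ∈ Iᶜ} => xπ 0 j.1 - x 0 j.1)‖ ≤ c' * ‖π‖) := by
  obtain ⟨hs0, hsT⟩ := hs
  obtain ⟨hxc, hx0, hx1, hxI, hxE⟩ := hx
  have hd₀ : DynSmooth n F₀ DF₀ x 0 s ρ L := hds₀.mono' le_rfl (by linarith)
  have hd₁ : DynSmooth n F₁ DF₁ x s T ρ L := hds₁.mono' (by linarith) le_rfl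
  have hS0 : Icc 0 s ⊆ Icc 0 T := Icc_subset_Icc le_rfl hsT.le
  have hS1 : Icc s T ⊆ Icc 0 T := Icc_subset_Icc hs0.le le_rfl
  have hA₀ := hd₀.contA hρ.le (hxc.mono hS0)
  have hA₁ := hd₁.contA hρ.le (hxc.mono hS1)
  -- invertibility of the fundamental matrix
  have hapc : ∀ v, ContinuousOn (fun t => Φ t v) (Icc 0 T) := fun v =>
    hΦc.clm_apply continuousOn_const
  have hap0 : ∀ v, ∀ t ∈ Ioo 0 s, HasDerivAt (fun t => Φ t v) (DF₀ (x t) t (Φ t v)) t := by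
    intro v t ht
    have := (hΦode t ⟨ht.1.le, (ht.2.trans hsT).le⟩ ht.2.ne).hasDerivAt
      (Icc_mem_nhds ht.1 (ht.2.trans hsT))
    rw [if_pos ht.2] at this
    simpa using this.clm_apply (hasDerivAt_const t v)
  have hap1 : ∀ v, ∀ t ∈ Ioo s T, HasDerivAt (fun t => Φ t v) (DF₁ (x t) t (Φ t v)) t := by
    intro v t ht
    have := (hΦode t ⟨(hs0.trans ht.1).le, ht.2.le⟩ ht.1.ne').hasDerivAt
      (Icc_mem_nhds (hs0.trans ht.1) ht.2)
    rw [if_neg (not_lt.2 ht.1.le)] at this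
    simpa using this.clm_apply (hasDerivAt_const t v)
  have hinj0 : ∀ t ∈ Icc 0 s, ∀ v, Φ t v = 0 → v = 0 := by
    intro t ht v hv
    have := backward_zero 0 t ht.1 (fun t => Φ t v) (fun t => DF₀ (x t) t)
      ((hapc v).mono (Icc_subset_Icc le_rfl (ht.2.trans hsT.le)))
      (hA₀.mono (Icc_subset_Icc le_rfl ht.2))
      (fun τ hτ => hap0 v τ ⟨hτ.1, hτ.2.trans_le ht.2⟩) hv
    simpa [hΦ0] using this
  have hinj : ∀ t ∈ Icc 0 T, ∀ v, Φ t v = 0 → v = 0 := by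
    intro t ht v hv
    rcases le_total t s with h | h
    · exact hinj0 t ⟨ht.1, h⟩ v hv
    · refine hinj0 s ⟨hs0.le, le_rfl⟩ v ?_
      exact backward_zero s t h (fun t => Φ t v) (fun t => DF₁ (x t) t)
        ((hapc v).mono (Icc_subset_Icc hs0.le ht.2))
        (hA₁.mono (Icc_subset_Icc le_rfl ht.2))
        (fun τ hτ => hap1 v τ ⟨hτ.1, hτ.2.trans_le ht.2⟩) hv
  have hunit : ∀ t ∈ Icc 0 T, IsUnit (Φ t) := by
    intro t ht
    rw [ContinuousLinearMap.isUnit_iff_bijective]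
    have hi : Function.Injective (Φ t : (Fin n → ℝ) →ₗ[ℝ] (Fin n → ℝ)) :=
      (injective_iff_map_eq_zero _).2 (hinj t ht)
    exact ⟨hi, LinearMap.injective_iff_surjective.1 hi⟩
  let Ψ : ℝ → (Fin n → ℝ) →L[ℝ] (Fin n → ℝ) := fun t => Ring.inverse (Φ t)
  have hΨc : ContinuousOn Ψ (Icc 0 T) := by
    intro t ht
    obtain ⟨u, hu⟩ := hunit t ht
    have := NormedRing.inverse_continuousAt u
    rw [hu] at this
    exact this.comp_continuousWithinAt (hΦc t ht)
  have hΦΨ : ∀ t ∈ Icc 0 T, ∀ v, Φ t (Ψ t v) = v := by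
    intro t ht v
    have := Ring.mul_inverse_cancel (Φ t) (hunit t ht)
    exact congrArg (fun A : (Fin n → ℝ) →L[ℝ] (Fin n → ℝ) => A v) this
  obtain ⟨M₁, hM₁⟩ := isCompact_Icc.exists_bound_of_continuousOn hΦc
  obtain ⟨M₂, hM₂⟩ := isCompact_Icc.exists_bound_of_continuousOn hΨc
  obtain ⟨M, hΦM, hΨM, hM0⟩ : ∃ M : ℝ, (∀ t ∈ Icc 0 T, ‖Φ t‖ ≤ M) ∧ (∀ t ∈ Icc 0 T, ‖Ψ t‖ ≤ M) ∧
      0 ≤ M :=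
    ⟨max M₁ M₂, fun t ht => (hM₁ t ht).trans (le_max_left _ _),
      fun t ht => (hM₂ t ht).trans (le_max_right _ _),
      (norm_nonneg _).trans ((hM₁ 0 ⟨le_rfl, hT.le⟩).trans (le_max_left _ _))⟩
  -- the boundary operator
  let Bl : (Fin n → ℝ) →ₗ[ℝ] (Fin n → ℝ) :=
    (embJ Iᶜ).comp ((Matrix.mulVecLin N).comp
      ((LinearMap.funLeft ℝ ℝ (Subtype.val : {e // e ∈ E} → Fin n)).comp
        (Φ T : (Fin n → ℝ) →ₗ[ℝ] Fin n → ℝ)))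
  let B : (Fin n → ℝ) →L[ℝ] (Fin n → ℝ) := LinearMap.toContinuousLinearMap Bl
  have hB : ∀ v, B v = embJ Iᶜ (N.mulVec (fun e : {e // e ∈ E} => Φ T v e.1)) := fun v => rfl
  have main : ∀ c' : ℝ, c' > ‖LinearMap.toContinuousLinearMap (Matrix.mulVecLin N)‖ →
      ∃ ε > (0 : ℝ), ∀ π : {e // e ∈ E} → ℝ, ‖π‖ ≤ ε →
      ∃ xπ : ℝ → Fin n → ℝ, IsPertSol T s I E bI bE F₀ F₁ π xπ ∧
        ‖(fun j : {j // j ∈ Iᶜ} => xπ 0 j.1 - x 0 j.1)‖ ≤ c' * ‖π‖ := by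
    intro c' hc'
    set γ := ‖LinearMap.toContinuousLinearMap (Matrix.mulVecLin N)‖ with hγ
    have hγ0 : 0 ≤ γ := norm_nonneg _
    have hc0 : 0 < c' := lt_of_le_of_lt hγ0 hc'
    obtain ⟨q, hq0, hq1, hqc⟩ : ∃ q : ℝ, 0 < q ∧ q < 1 ∧ γ / (1 - q) ≤ c' := by
      refine ⟨(c' - γ) / (2 * c'), div_pos (by linarith) (by linarith), ?_, ?_⟩
      · rw [div_lt_one (by linarith)]; linarith
      · have e1 : 1 - (c' - γ) / (2 * c') = (c' + γ) / (2 * c') := by field_simp; ring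
        rw [e1, div_le_iff₀ (by positivity)]
        have e2 : c' * ((c' + γ) / (2 * c')) = (c' + γ) / 2 := by field_simp
        rw [e2]; linarith
    let D := M * |L| * M * T * (1 + ‖B‖)
    have hD : 0 ≤ D := by positivity
    obtain ⟨δ, hδ0, hδρ, hδq⟩ : ∃ δ : ℝ, 0 < δ ∧ δ ≤ ρ ∧ D * δ ≤ q := by
      refine ⟨min ρ (q / (D + 1)), lt_min hρ (by positivity), min_le_left _ _, ?_⟩
      calc D * min ρ (q / (D + 1)) ≤ (D + 1) * (q / (D + 1)) :=
            mul_le_mul (by linarith) (min_le_right _ _) (by positivity) (by positivity)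
        _ = q := by field_simp
    obtain ⟨h₀, hc₀, hl₀, hz₀, he₀⟩ := hd₀.piece hs0.le (hxc.mono hS0) Φ Ψ (hΦc.mono hS0)
      (hΨc.mono hS0) M (fun t ht => hΦM t (hS0 ht)) (fun t ht => hΨM t (hS0 ht)) hδ0.le hδρ
    obtain ⟨h₁, hc₁, hl₁, hz₁, he₁⟩ := hd₁.piece hsT.le (hxc.mono hS1) Φ Ψ (hΦc.mono hS1)
      (hΨc.mono hS1) M (fun t ht => hΦM t (hS1 ht)) (fun t ht => hΨM t (hS1 ht)) hδ0.le hδρ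
    refine ⟨δ / (M * c' + 1), by positivity, fun π hπ => ?_⟩
    obtain ⟨z, hzc, hzn, hzd0, hzd1, hz0⟩ := bvp_core T s ⟨hs0, hsT⟩ h₀ h₁ hc₀ hc₁
      (M * (|L| * δ) * M) (by positivity) hl₀ hl₁ hz₀ hz₁ B (embJ Iᶜ (N.mulVec π)) q hq1
      (by
        refine le_trans (le_of_eq ?_) hδq
        simp only [D]; ring)
    have ha : ‖embJ Iᶜ (N.mulVec π)‖ ≤ γ * ‖π‖ :=
      (embJ_norm _ _).trans
        ((LinearMap.toContinuousLinearMap (Matrix.mulVecLin N)).le_opNorm π)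
    have hzn' : ∀ t, ‖z t‖ ≤ c' * ‖π‖ := by
      intro t
      calc ‖z t‖ ≤ _ := hzn t
        _ ≤ γ * ‖π‖ / (1 - q) := div_le_div_of_nonneg_right ha (by linarith)
        _ = γ / (1 - q) * ‖π‖ := by ring
        _ ≤ _ := mul_le_mul_of_nonneg_right hqc (norm_nonneg _)
    have hw : ∀ t ∈ Icc 0 T, ‖Φ t (z t)‖ ≤ δ := by
      intro t ht
      calc ‖Φ t (z t)‖ ≤ ‖Φ t‖ * ‖z t‖ := (Φ t).le_opNorm _
        _ ≤ M * (c' * (δ / (M * c' + 1))) := mul_le_mul (hΦM t ht)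
          ((hzn' t).trans (mul_le_mul_of_nonneg_left hπ hc0.le)) (norm_nonneg _) hM0
        _ = (M * c') / (M * c' + 1) * δ := by ring
        _ ≤ 1 * δ := by
          refine mul_le_mul_of_nonneg_right ?_ hδ0.le
          rw [div_le_one (by positivity)]; linarith
        _ = δ := one_mul δ
    -- the initial and terminal values
    have hz0' : z 0 = embJ Iᶜ (N.mulVec (π - fun e : {e // e ∈ E} => Φ T (z T - z 0) e.1)) := by
      rw [Matrix.mulVec_sub, map_sub, ← hB]; exact hz0
    have hterm : ∀ e : {e // e ∈ E}, Φ T (z T) e.1 = π e := by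
      intro e
      have h1 := apply_embJ Iᶜ E (Φ T)
        (N.mulVec (π - fun e : {e // e ∈ E} => Φ T (z T - z 0) e.1)) e
      rw [← hz0', Matrix.mulVec_mulVec, hN₁, Matrix.one_mulVec] at h1
      simp only [map_sub, Pi.sub_apply] at h1
      linarith
    refine ⟨fun t => x t + Φ t (z t), ⟨?_, ?_, ?_, ?_, ?_⟩, ?_⟩
    · exact hxc.add (hΦc.clm_apply hzc.continuousOn)
    · intro t ht
      have htT : t ∈ Icc 0 T := ⟨ht.1, (ht.2.trans hsT).le⟩
      have dΦ := hΦode t htT ht.2.ne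
      rw [if_pos ht.2] at dΦ
      have d := (hx0 t ht).add (dΦ.clm_apply (hzd0 t ht))
      refine d.congr_deriv ?_
      rw [he₀ t ⟨ht.1, ht.2.le⟩ _ (hw t htT), hΦΨ t htT, ContinuousLinearMap.comp_apply]
      abel
    · intro t ht
      have htT : t ∈ Icc 0 T := ⟨(hs0.trans ht.1).le, ht.2⟩
      have dΦ := hΦode t htT ht.1.ne'
      rw [if_neg (not_lt.2 ht.1.le)] at dΦ
      have d := (hx1 t ht).add (dΦ.clm_apply (hzd1 t ht))
      refine d.congr_deriv ?_
      rw [he₁ t ⟨ht.1.le, ht.2⟩ _ (hw t htT), hΦΨ t htT, ContinuousLinearMap.comp_apply]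
      abel
    · intro i hi
      have : z 0 i = 0 := by rw [hz0']; exact embJ_not_mem _ _ _ (by simpa using hi)
      simp [hΦ0, hxI i hi, this]
    · intro e
      have := hxE e
      simp only [Pi.zero_apply, add_zero] at this
      simp [this, hterm e]
    · have e1 : (fun j : {j // j ∈ Iᶜ} => (x 0 + Φ 0 (z 0)) j.1 - x 0 j.1) =
          fun j : {j // j ∈ Iᶜ} => z 0 j.1 := by
        funext j; simp [hΦ0]
      refine le_trans (le_of_eq (congrArg norm e1)) ?_
      refine le_trans ?_ (hzn' 0)
      rw [pi_norm_le_iff_of_nonneg (norm_nonneg _)]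
      exact fun j => norm_le_pi_norm (z 0) j.1
  refine ⟨?_, main⟩
  obtain ⟨ε, hε, h⟩ := main (‖LinearMap.toContinuousLinearMap (Matrix.mulVecLin N)‖ + 1) (by linarith)
  exact ⟨ε, hε, _, h⟩
end

section
/- Assume Dynamics Smoothness holds. Let Δs ∈ (0, ρ], define the perturbed switched dynamics F⁺(χ,t) = F₀(χ,t) for t ∈ [0, s+Δs) and F⁺(χ,t) = F₁(χ,t) for t ∈ (s+Δs, T], and let y⁺ : [0,T] → ℝⁿ be a solution of ẏ(t) = F⁺(y(t),t) with y⁺(0) = x(0), satisfying y⁺(t) = x(t) on [0,s] and ‖y⁺(t) − x(t)‖ ≤ κΔs for all t ∈ [0,T] for some constant κ, with (y⁺(t), t) remaining in the tubes T₀, T₁ on the corresponding time intervals. Let Φ⁺ : [0,T] → ℝ^{n×n} solve Φ̇⁺(t) = ∇ₓF⁺(y⁺(t),t)Φ⁺(t) for t ∉ {s+Δs}, Φ⁺(0) = I. Then there is a constant C, independent of Δs, such that ‖Φ⁺(T) − Φ(T)‖ ≤ CΔs for all sufficiently small Δs > 0. -/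
open Set Metric

lemma gronwall_open {E : Type*} [NormedAddCommGroup E] [NormedSpace ℝ E]
    (f f' : ℝ → E) (a b K ε : ℝ) (hab : a ≤ b) (hK : 0 < K) (hε : 0 ≤ ε)
    (hc : ContinuousOn f (Icc a b))
    (hd : ∀ t ∈ Ioo a b, HasDerivAt f (f' t) t)
    (hb : ∀ t ∈ Ioo a b, ‖f' t‖ ≤ K * ‖f t‖ + ε) :
    ‖f b‖ ≤ (‖f a‖ + ε * (b - a)) * Real.exp (K * (b - a)) := by
  rcases hab.eq_or_lt with rfl | hlt
  · simp
  have key : ∀ a' ∈ Ioo a b,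
      ‖f b‖ ≤ (‖f a'‖ + ε * (b - a)) * Real.exp (K * (b - a)) := by
    intro a' ha'
    have h1 := norm_le_gronwallBound_of_norm_deriv_right_le (f := f) (f' := f')
      (δ := ‖f a'‖) (K := K) (ε := ε) (a := a') (b := b)
      (hc.mono (Icc_subset_Icc_left ha'.1.le))
      (fun t ht => (hd t ⟨ha'.1.trans_le ht.1, ht.2⟩).hasDerivWithinAt) le_rfl
      (fun t ht => hb t ⟨ha'.1.trans_le ht.1, ht.2⟩) b ⟨ha'.2.le, le_rfl⟩
    rw [gronwallBound_of_K_ne_0 hK.ne'] at h1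
    have h2 : Real.exp (K * (b - a')) ≤ Real.exp (K * (b - a)) := by
      apply Real.exp_le_exp.2
      nlinarith [ha'.1]
    set u := K * (b - a) with hu
    have h3 : Real.exp u - 1 ≤ u * Real.exp u := by
      have h4 := Real.add_one_le_exp (-u)
      have h5 : Real.exp (-u) * Real.exp u = 1 := by rw [← Real.exp_add]; simp
      nlinarith [Real.exp_pos u]
    calc ‖f b‖ ≤ ‖f a'‖ * Real.exp (K * (b - a')) + ε / K * (Real.exp (K * (b - a')) - 1) := h1
      _ ≤ ‖f a'‖ * Real.exp u + ε / K * (Real.exp u - 1) := by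
          have : 0 ≤ ε / K := by positivity
          gcongr
      _ ≤ ‖f a'‖ * Real.exp u + ε / K * (u * Real.exp u) := by gcongr
      _ = _ := by rw [hu]; field_simp
  have hca : ContinuousWithinAt f (Ioo a b) a :=
    (hc a ⟨le_rfl, hab⟩).mono Ioo_subset_Icc_self
  have ht : Filter.Tendsto (fun a' => (‖f a'‖ + ε * (b - a)) * Real.exp (K * (b - a)))
      (nhdsWithin a (Ioo a b)) (nhds ((‖f a‖ + ε * (b - a)) * Real.exp (K * (b - a)))) :=
    (hca.norm.tendsto.add_const _).mul_const _
  have : (nhdsWithin a (Ioo a b)).NeBot := by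
    rw [nhdsWithin_Ioo_eq_nhdsGT hlt]; infer_instance
  exact ge_of_tendsto ht (by filter_upwards [self_mem_nhdsWithin] with a' h using key a' h)

lemma fund_step {E : Type*} [NormedAddCommGroup E] [NormedSpace ℝ E]
    (P Q A A' : ℝ → E →L[ℝ] E) (T a b K ε B : ℝ) (ha : 0 ≤ a) (hbT : b ≤ T)
    (hab : a ≤ b) (hK : 0 < K) (hε : 0 ≤ ε) (hB : 0 ≤ B)
    (hPc : ContinuousOn P (Icc 0 T)) (hQc : ContinuousOn Q (Icc 0 T))
    (hP : ∀ t ∈ Ioo a b, HasDerivWithinAt P ((A' t).comp (P t)) (Icc 0 T) t)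
    (hQ : ∀ t ∈ Ioo a b, HasDerivWithinAt Q ((A t).comp (Q t)) (Icc 0 T) t)
    (hA : ∀ t ∈ Ioo a b, ‖A' t‖ ≤ K) (hAA : ∀ t ∈ Ioo a b, ‖A' t - A t‖ ≤ ε)
    (hQB : ∀ t ∈ Icc 0 T, ‖Q t‖ ≤ B) :
    ‖P b - Q b‖ ≤ (‖P a - Q a‖ + ε * B * (b - a)) * Real.exp (K * (b - a)) := by
  have hsub : Icc a b ⊆ Icc 0 T := Icc_subset_Icc ha hbT
  refine gronwall_open (fun t => P t - Q t)
    (fun t => (A' t).comp (P t) - (A t).comp (Q t)) a b K (ε * B) hab hK (by positivity)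
    ((hPc.sub hQc).mono hsub) ?_ ?_
  · intro t ht
    have hm : Icc 0 T ∈ nhds t := Icc_mem_nhds (ha.trans_lt ht.1) (ht.2.trans_le hbT)
    exact ((hP t ht).hasDerivAt hm).sub ((hQ t ht).hasDerivAt hm)
  · intro t ht
    have e : (A' t).comp (P t) - (A t).comp (Q t)
        = (A' t).comp (P t - Q t) + (A' t - A t).comp (Q t) := by
      ext v; simp
    calc ‖(A' t).comp (P t) - (A t).comp (Q t)‖
        ≤ ‖(A' t).comp (P t - Q t)‖ + ‖(A' t - A t).comp (Q t)‖ := by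
          rw [e]; exact norm_add_le _ _
      _ ≤ ‖A' t‖ * ‖P t - Q t‖ + ‖A' t - A t‖ * ‖Q t‖ :=
          add_le_add (ContinuousLinearMap.opNorm_comp_le _ _)
            (ContinuousLinearMap.opNorm_comp_le _ _)
      _ ≤ K * ‖P t - Q t‖ + ε * B := by
          gcongr
          · exact hA t ht
          · exact hAA t ht
          · exact hQB t (hsub ⟨ht.1.le, ht.2.le⟩)

lemma jac_bound {n : ℕ} (Fd : (Fin n → ℝ) → ℝ → Fin n → ℝ)
    (DFd : (Fin n → ℝ) → ℝ → (Fin n → ℝ) →L[ℝ] (Fin n → ℝ))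
    (x : ℝ → Fin n → ℝ) (a b ρ L T : ℝ) (hρ : 0 < ρ)
    (hxc : ContinuousOn x (Icc 0 T)) (h : DynSmooth n Fd DFd x a b ρ L) :
    ∃ M : ℝ, ∀ t ∈ Icc a b, t ∈ Icc 0 T → ∀ χ, ‖χ - x t‖ ≤ ρ → ‖DFd χ t‖ ≤ M := by
  have hcomp : IsCompact (Icc a b ∩ Icc 0 T) := isCompact_Icc.inter isCompact_Icc
  have hc : ContinuousOn (fun t => DFd (x t) t) (Icc a b ∩ Icc 0 T) := by
    refine h.contDeriv.comp (f := fun t => (x t, t))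
      ((hxc.mono inter_subset_right).prodMk continuousOn_id) ?_
    intro t ht
    exact ⟨ht.1, by simpa using hρ.le⟩
  obtain ⟨M, hM⟩ := hcomp.exists_bound_of_continuousOn hc
  refine ⟨M + |L| * ρ, fun t ht ht' χ hχ => ?_⟩
  have h1 := h.lip t χ (x t) ht hχ (by simpa using hρ.le)
  have h2 := hM t ⟨ht, ht'⟩
  have h3 : L * ‖χ - x t‖ ≤ |L| * ρ := by
    have := le_abs_self L
    gcongr
  have h4 := norm_sub_norm_le (DFd χ t) (DFd (x t) t)
  linarith

/-- the fundamental matrix of the problem with perturbed switch point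
differs from the unperturbed one by `O(Δs)` at the terminal time. -/
theorem perturbed_fundamental_matrix_estimate
    {n : ℕ} (hn : 0 < n) (T s ρ L κ : ℝ) (hT : 0 < T) (hs : s ∈ Ioo 0 T) (hρ : 0 < ρ)
    (F₀ F₁ : (Fin n → ℝ) → ℝ → Fin n → ℝ)
    (DF₀ DF₁ : (Fin n → ℝ) → ℝ → (Fin n → ℝ) →L[ℝ] (Fin n → ℝ))
    (x : ℝ → Fin n → ℝ)
    -- `x` solves the switched dynamics
    (hxc : ContinuousOn x (Icc 0 T))
    (hx₀ : ∀ t ∈ Ico 0 s, HasDerivWithinAt x (F₀ (x t) t) (Icc 0 T) t)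
    (hx₁ : ∀ t ∈ Ioc s T, HasDerivWithinAt x (F₁ (x t) t) (Icc 0 T) t)
    -- Dynamics Smoothness on the two tubes
    (hds₀ : DynSmooth n F₀ DF₀ x 0 (s + ρ) ρ L)
    (hds₁ : DynSmooth n F₁ DF₁ x (s - ρ) T ρ L)
    -- the fundamental matrix `Φ` of the linearized dynamics along `x`
    (Φ : ℝ → (Fin n → ℝ) →L[ℝ] (Fin n → ℝ))
    (hΦc : ContinuousOn Φ (Icc 0 T))
    (hΦ0 : Φ 0 = ContinuousLinearMap.id ℝ (Fin n → ℝ))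
    (hΦode : ∀ t ∈ Icc 0 T, t ≠ s → HasDerivWithinAt Φ
      ((if t < s then DF₀ (x t) t else DF₁ (x t) t).comp (Φ t)) (Icc 0 T) t)
    -- for `Δs ∈ (0,ρ]`: `yp Δs` solves the dynamics switched at `s + Δs` with
    -- `yp Δs 0 = x 0`, agrees with `x` on `[0,s]`, satisfies `‖yp Δs - x‖ ≤ κ Δs`,
    -- and stays in the tubes
    (yp : ℝ → ℝ → Fin n → ℝ)
    (hypc : ∀ Δs ∈ Ioc (0 : ℝ) ρ, ContinuousOn (yp Δs) (Icc 0 T))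
    (hyp₀ : ∀ Δs ∈ Ioc (0 : ℝ) ρ, ∀ t ∈ Ico 0 (s + Δs),
      HasDerivWithinAt (yp Δs) (F₀ (yp Δs t) t) (Icc 0 T) t)
    (hyp₁ : ∀ Δs ∈ Ioc (0 : ℝ) ρ, ∀ t ∈ Ioc (s + Δs) T,
      HasDerivWithinAt (yp Δs) (F₁ (yp Δs t) t) (Icc 0 T) t)
    (hyp0 : ∀ Δs ∈ Ioc (0 : ℝ) ρ, yp Δs 0 = x 0)
    (hypeq : ∀ Δs ∈ Ioc (0 : ℝ) ρ, ∀ t ∈ Icc 0 s, yp Δs t = x t)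
    (hypκ : ∀ Δs ∈ Ioc (0 : ℝ) ρ, ∀ t ∈ Icc 0 T, ‖yp Δs t - x t‖ ≤ κ * Δs)
    (hyptube : ∀ Δs ∈ Ioc (0 : ℝ) ρ, ∀ t ∈ Icc 0 T, ‖yp Δs t - x t‖ ≤ ρ)
    -- `Φp Δs` is the fundamental matrix of the linearized dynamics along `yp Δs`,
    -- switched at `s + Δs`
    (Φp : ℝ → ℝ → (Fin n → ℝ) →L[ℝ] (Fin n → ℝ))
    (hΦpc : ∀ Δs ∈ Ioc (0 : ℝ) ρ, ContinuousOn (Φp Δs) (Icc 0 T))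
    (hΦp0 : ∀ Δs ∈ Ioc (0 : ℝ) ρ, Φp Δs 0 = ContinuousLinearMap.id ℝ (Fin n → ℝ))
    (hΦpode : ∀ Δs ∈ Ioc (0 : ℝ) ρ, ∀ t ∈ Icc 0 T, t ≠ s + Δs →
      HasDerivWithinAt (Φp Δs)
        ((if t < s + Δs then DF₀ (yp Δs t) t else DF₁ (yp Δs t) t).comp (Φp Δs t))
        (Icc 0 T) t) :
    -- conclusion: `‖Φ⁺(T) - Φ(T)‖ ≤ C Δs` for all sufficiently small `Δs > 0`
    ∃ c : ℝ, ∃ η > (0 : ℝ), ∀ Δs : ℝ, 0 < Δs → Δs ≤ ρ → Δs ≤ η →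
      ‖Φp Δs T - Φ T‖ ≤ c * Δs := by
  obtain ⟨M₀, hM₀⟩ := jac_bound F₀ DF₀ x _ _ ρ L T hρ hxc hds₀
  obtain ⟨M₁, hM₁⟩ := jac_bound F₁ DF₁ x _ _ ρ L T hρ hxc hds₁
  obtain ⟨B', hB'⟩ := isCompact_Icc.exists_bound_of_continuousOn hΦc
  obtain ⟨K, hKpos, hK0, hK1⟩ : ∃ K : ℝ, 0 < K ∧ M₀ ≤ K ∧ M₁ ≤ K :=
    ⟨max 1 (max M₀ M₁), by positivity, by simp, by simp⟩
  obtain ⟨B, hB, hΦB⟩ : ∃ B : ℝ, 0 ≤ B ∧ ∀ t ∈ Icc 0 T, ‖Φ t‖ ≤ B :=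
    ⟨|B'|, abs_nonneg _, fun t ht => (hB' t ht).trans (le_abs_self _)⟩
  obtain ⟨hs0, hsT⟩ := hs
  refine ⟨(2 * K * B * Real.exp (K * T) + |L| * |κ| * B * T) * Real.exp (K * T),
    T - s, by linarith, ?_⟩
  intro d hd hdρ hdη
  have hdm : d ∈ Ioc (0 : ℝ) ρ := ⟨hd, hdρ⟩
  have hx0 : ∀ t, ‖x t - x t‖ ≤ ρ := fun t => by simpa using hρ.le
  -- first interval
  have s1 := fund_step (Φp d) Φ (fun t => DF₀ (x t) t) (fun t => DF₀ (yp d t) t) T 0 s K 0 B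
    le_rfl hsT.le hs0.le hKpos le_rfl hB (hΦpc d hdm) hΦc
    (fun t ht => by
      have := hΦpode d hdm t ⟨ht.1.le, by linarith [ht.2]⟩ (by linarith [ht.2])
      rwa [if_pos (by linarith [ht.2])] at this)
    (fun t ht => by
      have := hΦode t ⟨ht.1.le, by linarith [ht.2]⟩ ht.2.ne
      rwa [if_pos ht.2] at this)
    (fun t ht => (hM₀ t ⟨ht.1.le, by linarith [ht.2]⟩ ⟨ht.1.le, by linarith [ht.2]⟩ _
      (hyptube d hdm t ⟨ht.1.le, by linarith [ht.2]⟩)).trans hK0)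
    (fun t ht => by simp [hypeq d hdm t ⟨ht.1.le, ht.2.le⟩])
    hΦB
  rw [hΦp0 d hdm, hΦ0] at s1
  simp only [sub_self, norm_zero, zero_mul, add_zero] at s1
  -- second interval
  have s2 := fund_step (Φp d) Φ (fun t => DF₁ (x t) t) (fun t => DF₀ (yp d t) t) T s (s + d)
    K (2 * K) B hs0.le (by linarith) (by linarith) hKpos (by positivity) hB (hΦpc d hdm) hΦc
    (fun t ht => by
      have := hΦpode d hdm t ⟨by linarith [ht.1], by linarith [ht.2]⟩ ht.2.ne
      rwa [if_pos ht.2] at this)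
    (fun t ht => by
      have := hΦode t ⟨by linarith [ht.1], by linarith [ht.2]⟩ ht.1.ne'
      rwa [if_neg (not_lt.2 ht.1.le)] at this)
    (fun t ht => by
      have hm : t ∈ Icc 0 T := ⟨by linarith [ht.1], by linarith [ht.2]⟩
      exact (hM₀ t ⟨hm.1, by linarith [ht.2]⟩ hm _ (hyptube d hdm t hm)).trans hK0)
    (fun t ht => by
      have hm : t ∈ Icc 0 T := ⟨by linarith [ht.1], by linarith [ht.2]⟩
      have e1 := (hM₀ t ⟨hm.1, by linarith [ht.2]⟩ hm _ (hyptube d hdm t hm)).trans hK0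
      have e2 := (hM₁ t ⟨by linarith [ht.1], hm.2⟩ hm _ (hx0 t)).trans hK1
      have e3 := norm_sub_le (DF₀ (yp d t) t) (DF₁ (x t) t)
      linarith)
    hΦB
  -- third interval
  have s3 := fund_step (Φp d) Φ (fun t => DF₁ (x t) t) (fun t => DF₁ (yp d t) t) T (s + d) T
    K (|L| * (|κ| * d)) B (by linarith) le_rfl (by linarith) hKpos (by positivity) hB
    (hΦpc d hdm) hΦc
    (fun t ht => by
      have := hΦpode d hdm t ⟨by linarith [ht.1], by linarith [ht.2]⟩ ht.1.ne'
      rwa [if_neg (not_lt.2 ht.1.le)] at this)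
    (fun t ht => by
      have := hΦode t ⟨by linarith [ht.1], by linarith [ht.2]⟩ (by linarith [ht.1])
      rwa [if_neg (by linarith [ht.1])] at this)
    (fun t ht => by
      have hm : t ∈ Icc 0 T := ⟨by linarith [ht.1], by linarith [ht.2]⟩
      exact (hM₁ t ⟨by linarith [ht.1], hm.2⟩ hm _ (hyptube d hdm t hm)).trans hK1)
    (fun t ht => by
      have hm : t ∈ Icc 0 T := ⟨by linarith [ht.1], by linarith [ht.2]⟩
      have e1 := hds₁.lip t (yp d t) (x t) ⟨by linarith [ht.1], hm.2⟩ (hyptube d hdm t hm) (hx0 t)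
      have e2 : ‖yp d t - x t‖ ≤ |κ| * d :=
        (hypκ d hdm t hm).trans (by gcongr; exact le_abs_self κ)
      refine e1.trans ?_
      have := le_abs_self L
      gcongr)
    hΦB
  have hz : ‖Φp d s - Φ s‖ = 0 := le_antisymm s1 (norm_nonneg _)
  rw [hz, zero_add, add_sub_cancel_left] at s2
  have x1 : Real.exp (K * d) ≤ Real.exp (K * T) := by
    apply Real.exp_le_exp.2; gcongr; linarith
  have x2 : Real.exp (K * (T - (s + d))) ≤ Real.exp (K * T) := by
    apply Real.exp_le_exp.2; gcongr; linarith
  have hTs : 0 ≤ T - (s + d) := by linarith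
  calc ‖Φp d T - Φ T‖ ≤ _ := s3
    _ ≤ (2 * K * B * d * Real.exp (K * T) + |L| * (|κ| * d) * B * T) * Real.exp (K * T) := by
        have y1 : ‖Φp d (s + d) - Φ (s + d)‖ ≤ 2 * K * B * d * Real.exp (K * T) :=
          s2.trans (by gcongr)
        have y2 : T - (s + d) ≤ T := by linarith
        gcongr
    _ = _ := by ring
end
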